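/- arXiv:2507.04016 — 8 statements merged into one kernel-verified Lean document; each statement's English description precedes it below -/
import Mathlib

section
/- Let m, K ≥ 1 be integers and let L : [m] × [K] → ℝ be arbitrary (L(i,k) representing the load of machine i in scenario k). Then there exists a machine i ∈ [m] that is (⌈m/K⌉ − 1)-favorable with respect to every scenario, i.e., for every k ∈ [K] there are at least ⌈m/K⌉ − 1 machines i' ∈ [m] with i' ≠ i and L(i',k) ≥ L(i,k). -/
/-- At most `s` elements have fewer than `s` other elements whose value is at least theirs. -/
theorem card_filter_card_lt_le {α β : Type*} [Fintype α] [DecidableEq α] [LinearOrder β]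
    (f : α → β) (s : ℕ) :
    (Finset.univ.filter fun i : α =>
      (Finset.univ.filter fun i' : α => i' ≠ i ∧ f i ≤ f i').card < s).card ≤ s := by
  set B := Finset.univ.filter fun i : α =>
    (Finset.univ.filter fun i' : α => i' ≠ i ∧ f i ≤ f i').card < s with hB
  rcases B.eq_empty_or_nonempty with h | h
  · simp [h]
  obtain ⟨i, hi, hmin⟩ := B.exists_min_image f h
  have hsub : B.erase i ⊆ Finset.univ.filter fun i' : α => i' ≠ i ∧ f i ≤ f i' := by
    intro j hj
    rw [Finset.mem_erase] at hj
    simpa using ⟨hj.1, hmin j hj.2⟩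
  have hcard := Finset.card_le_card hsub
  rw [Finset.card_erase_of_mem hi] at hcard
  have hlt := (Finset.mem_filter.mp hi).2
  omega

/-- **Pigeonhole observation.** For `m, K ≥ 1` and arbitrary loads `L i k` of machine `i`
in scenario `k`, there is a machine `i` that is `(⌈m/K⌉ - 1)`-favorable with respect to every
scenario: for every scenario `k` there are at least `⌈m/K⌉ - 1` machines `i' ≠ i` whose load
in scenario `k` is at least that of `i`. -/
theorem exists_favorable_machine (m K : ℕ) (hm : 1 ≤ m) (hK : 1 ≤ K)
    (L : Fin m → Fin K → ℝ) :
    ∃ i : Fin m, ∀ k : Fin K,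
      ⌈(m : ℚ) / (K : ℚ)⌉ - 1 ≤
        ((Finset.univ.filter (fun i' : Fin m => i' ≠ i ∧ L i k ≤ L i' k)).card : ℤ) := by
  have hKpos : (0 : ℚ) < K := by exact_mod_cast hK
  have hceil : 0 < ⌈(m : ℚ) / (K : ℚ)⌉ :=
    Int.ceil_pos.mpr (div_pos (by exact_mod_cast hm) hKpos)
  obtain ⟨s, hs⟩ := Int.eq_ofNat_of_zero_le (Int.le_sub_one_of_lt hceil)
  have hsm : K * s < m := by
    have h : (s : ℤ) < ⌈(m : ℚ) / (K : ℚ)⌉ := by omega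
    rw [Int.lt_ceil, lt_div_iff₀ hKpos, mul_comm] at h
    exact_mod_cast h
  rw [hs]
  by_contra! hbad
  have hcover : (Finset.univ : Finset (Fin m)) ⊆ Finset.univ.biUnion fun k : Fin K =>
      Finset.univ.filter fun i : Fin m =>
        (Finset.univ.filter fun i' : Fin m => i' ≠ i ∧ L i k ≤ L i' k).card < s := by
    intro i _
    obtain ⟨k, hk⟩ := hbad i
    exact Finset.mem_biUnion.mpr
      ⟨k, Finset.mem_univ k, Finset.mem_filter.mpr ⟨Finset.mem_univ i, by exact_mod_cast hk⟩⟩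
  have hcard := (Finset.card_le_card hcover).trans
    (Finset.card_biUnion_le_card_mul _ _ s fun k _ => card_filter_card_lt_le (fun i => L i k) s)
  simp only [Finset.card_univ, Fintype.card_fin] at hcard
  omega
end

section
/- For all integers m > K ≥ 1, there exists a deterministic online algorithm for OMSS(m,K) that is (1 + (m−1)/⌈m/K⌉)-competitive. -/
open Finset

/-- An instance of Online Makespan Scheduling under Scenarios with `K` scenarios:
`n` jobs `1,…,n`, nonnegative processing times `p`, and scenarios `S k ⊆ {1,…,n}`. -/
structure OMSSInstance (K : ℕ) where
  n : ℕ
  p : ℕ → ℝ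
  hp : ∀ j, 0 ≤ p j
  S : Fin K → Finset ℕ
  hS : ∀ k, S k ⊆ Finset.Icc 1 n

/-- A deterministic online algorithm for `OMSS(m,K)`: the machine for job `j` is a
function only of `j`, the processing times revealed so far, and the partial scenarios. -/
abbrev OnlineAlg (m K : ℕ) := ℕ → (ℕ → ℝ) → (Fin K → Finset ℕ) → Fin m

/-- The assignment produced by online algorithm `A` on instance `I`:
for job `j` the algorithm only sees `p_1,…,p_j` and `S_k ∩ [j]`. -/
noncomputable def algAssign {m K : ℕ} (A : OnlineAlg m K) (I : OMSSInstance K) : ℕ → Fin m :=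
  fun j => A j (fun j' => if j' ≤ j then I.p j' else 0) (fun k => I.S k ∩ Finset.Icc 1 j)

/-- Load of machine `i` in scenario `k` under assignment `τ`. -/
noncomputable def load {m K : ℕ} (I : OMSSInstance K) (τ : ℕ → Fin m) (i : Fin m)
    (k : Fin K) : ℝ :=
  ∑ j ∈ (I.S k).filter (fun j => τ j = i), I.p j

/-- Makespan of an assignment: the largest load of a machine in a scenario. -/
noncomputable def mkspan {m K : ℕ} (I : OMSSInstance K) (τ : ℕ → Fin m) : ℝ :=
  sSup {x | ∃ k : Fin K, ∃ i : Fin m, x = load I τ i k}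

/-- Offline optimum makespan over all assignments to `m` machines. -/
noncomputable def OPT (m : ℕ) {K : ℕ} (I : OMSSInstance K) : ℝ :=
  sInf {x | ∃ τ : ℕ → Fin m, x = mkspan I τ}

/-- Some machine minimizes the maximum load over the scenarios in `T`. -/
theorem exists_machine_minimizing_max_load {m K : ℕ} [Nonempty (Fin m)]
    (l : Fin m → Fin K → ℝ) (T : Finset (Fin K)) :
    ∃ i, ∀ i', ∀ k ∈ T, ∃ k' ∈ T, l i k ≤ l i' k' := by
  rcases T.eq_empty_or_nonempty with rfl | hT
  · simp
  · obtain ⟨i, hi⟩ := Finite.exists_min (fun i => T.sup' hT (l i))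
    refine ⟨i, fun i' k hk => ?_⟩
    obtain ⟨k', hk', h⟩ := T.exists_mem_eq_sup' hT (l i')
    exact ⟨k', hk', (T.le_sup' (l i) hk).trans ((hi i').trans h.le)⟩

/-- A machine minimizing the maximum load over the scenarios in `T`. -/
noncomputable def leastLoadedMachine {m K : ℕ} [Nonempty (Fin m)]
    (l : Fin m → Fin K → ℝ) (T : Finset (Fin K)) : Fin m :=
  (exists_machine_minimizing_max_load l T).choose

/-- Extended List Scheduling: job `j` goes to a machine minimizing the current maximum load
over the scenarios that contain `j`. -/
noncomputable def listScheduling {m K : ℕ} [Nonempty (Fin m)] (p : ℕ → ℝ)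
    (S : Fin K → Finset ℕ) (j : ℕ) : Fin m :=
  leastLoadedMachine
    (fun i k => ∑ j' : Fin j, if j'.1 ∈ S k ∧ listScheduling p S j'.1 = i then p j'.1 else 0)
    {k | j ∈ S k}
termination_by j
decreasing_by exact j'.2

theorem listScheduling_congr {m K : ℕ} [Nonempty (Fin m)] {p p' : ℕ → ℝ}
    {S S' : Fin K → Finset ℕ} (j : ℕ) (hp : ∀ j' ≤ j, p j' = p' j')
    (hS : ∀ j' ≤ j, ∀ k, j' ∈ S k ↔ j' ∈ S' k) :
    (listScheduling p S j : Fin m) = listScheduling p' S' j := by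
  induction j using Nat.strong_induction_on with
  | _ j ih =>
    rw [listScheduling, listScheduling]
    congr 1
    · funext i k
      refine Finset.sum_congr rfl fun j' _ => ?_
      simp only [ih j' j'.2 (fun a ha => hp a (ha.trans j'.2.le))
        (fun a ha => hS a (ha.trans j'.2.le)), hp j' j'.2.le, hS j' j'.2.le k]
    · ext k
      simp [hS j le_rfl k]

theorem algAssign_listScheduling {m K : ℕ} [Nonempty (Fin m)] (I : OMSSInstance K) :
    algAssign (fun j p S => (listScheduling p S j : Fin m)) I = listScheduling I.p I.S := by
  funext j
  refine listScheduling_congr j (fun j' h => if_pos h) fun j' h k => ?_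
  simp only [Finset.mem_inter, Finset.mem_Icc, and_iff_left_iff_imp]
  exact fun hk => ⟨(Finset.mem_Icc.1 (I.hS k hk)).1, h⟩

/-- When `j` is assigned, each machine has, in some scenario containing `j`, at least the load
that the chosen machine has in a given scenario containing `j`. -/
theorem listScheduling_spec {m K : ℕ} [Nonempty (Fin m)] (p : ℕ → ℝ) (S : Fin K → Finset ℕ)
    {j : ℕ} {k : Fin K} (hk : j ∈ S k) (i' : Fin m) :
    ∃ k', j ∈ S k' ∧
      ∑ a ∈ S k with a < j ∧ listScheduling p S a = (listScheduling p S j : Fin m), p a ≤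
        ∑ a ∈ S k' with a < j ∧ listScheduling p S a = i', p a := by
  have hsum (i : Fin m) (k : Fin K) :
      ∑ a : Fin j, (if a.1 ∈ S k ∧ listScheduling p S a.1 = i then p a.1 else 0) =
        ∑ a ∈ S k with a < j ∧ listScheduling p S a = i, p a := by
    rw [Fin.sum_univ_eq_sum_range
      (fun a => if a ∈ S k ∧ listScheduling p S a = i then p a else 0), ← Finset.sum_filter]
    refine Finset.sum_congr ?_ fun _ _ => rfl
    ext a
    simp only [Finset.mem_filter, Finset.mem_range]
    tauto
  obtain ⟨k', hk', h⟩ := (exists_machine_minimizing_max_load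
    (fun i k => ∑ a : Fin j, if a.1 ∈ S k ∧ listScheduling p S a.1 = i then p a.1 else 0)
    {k | j ∈ S k}).choose_spec i' k (by simpa using hk)
  refine ⟨k', by simpa using hk', ?_⟩
  rw [← hsum, ← hsum]
  conv_lhs => rw [listScheduling.eq_def p S j]
  exact h

theorem load_le_mkspan {m K : ℕ} (I : OMSSInstance K) (τ : ℕ → Fin m) (i : Fin m) (k : Fin K) :
    load I τ i k ≤ mkspan I τ := by
  refine le_csSup (Set.Finite.bddAbove ?_) ⟨k, i, rfl⟩
  refine (Set.finite_range fun q : Fin K × Fin m => load I τ q.2 q.1).subset ?_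
  rintro _ ⟨k, i, rfl⟩
  exact ⟨(k, i), rfl⟩

theorem le_OPT {m K : ℕ} [Nonempty (Fin m)] (I : OMSSInstance K) {x : ℝ}
    (h : ∀ τ : ℕ → Fin m, x ≤ mkspan I τ) : x ≤ OPT m I := by
  refine le_csInf ⟨_, fun _ => Classical.arbitrary _, rfl⟩ ?_
  rintro _ ⟨τ, rfl⟩
  exact h τ

theorem processing_time_le_OPT {m K : ℕ} [Nonempty (Fin m)] (I : OMSSInstance K) {j : ℕ}
    {k : Fin K} (hj : j ∈ I.S k) : I.p j ≤ OPT m I :=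
  le_OPT I fun τ => le_trans
    (Finset.single_le_sum (f := I.p) (fun a _ => I.hp a) (Finset.mem_filter.2 ⟨hj, Eq.refl (τ j)⟩))
    (load_le_mkspan I τ (τ j) k)

theorem sum_processing_times_le_mul_OPT {m K : ℕ} [Nonempty (Fin m)] (I : OMSSInstance K)
    (k : Fin K) : ∑ j ∈ I.S k, I.p j ≤ m * OPT m I := by
  have hm : (0 : ℝ) < m := Nat.cast_pos.2 (Fin.pos_iff_nonempty.2 ‹_›)
  rw [← div_le_iff₀' hm]
  refine le_OPT I fun τ => ?_
  rw [div_le_iff₀' hm, ← Finset.sum_fiberwise (I.S k) τ I.p]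
  calc ∑ i, load I τ i k ≤ ∑ _i : Fin m, mkspan I τ :=
        Finset.sum_le_sum fun i _ => load_le_mkspan I τ i k
    _ = m * mkspan I τ := by simp

theorem OPT_nonneg {m K : ℕ} [Nonempty (Fin m)] [Nonempty (Fin K)] (I : OMSSInstance K) :
    0 ≤ OPT m I :=
  le_OPT I fun τ => le_trans (Finset.sum_nonneg fun a _ => I.hp a)
    (load_le_mkspan I τ (Classical.arbitrary _) (Classical.arbitrary _))

/-- The load of the machine chosen for `j`, just before `j` is assigned. -/
theorem ceil_mul_load_add_le_mul_OPT {m K : ℕ} [Nonempty (Fin m)] (I : OMSSInstance K)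
    {j : ℕ} {k : Fin K} (hk : j ∈ I.S k) :
    (⌈(m : ℝ) / (K : ℝ)⌉ : ℝ) * ∑ a ∈ I.S k with
        a < j ∧ listScheduling I.p I.S a = (listScheduling I.p I.S j : Fin m), I.p a + I.p j ≤
      m * OPT m I := by
  set L := ∑ a ∈ I.S k with
    a < j ∧ listScheduling I.p I.S a = (listScheduling I.p I.S j : Fin m), I.p a with hL
  have hL0 : 0 ≤ L := Finset.sum_nonneg fun a _ => I.hp a
  have : Nonempty (Fin K) := ⟨k⟩
  have hK : (0 : ℝ) < K := Nat.cast_pos.2 (Fin.pos_iff_nonempty.2 ‹_›)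
  choose f hf hle using listScheduling_spec (m := m) I.p I.S hk
  obtain ⟨k', hk'⟩ := Fintype.exists_le_card_fiber_of_nsmul_le_card (M := ℝ) f
    (b := (m : ℝ) / K) (by simp [mul_div_cancel₀ _ hK.ne'])
  have hceil : (⌈(m : ℝ) / (K : ℝ)⌉ : ℝ) ≤ (#{i | f i = k'} : ℝ) := by
    exact_mod_cast Int.ceil_le.2 (by exact_mod_cast hk')
  have hj : j ∈ I.S k' := by
    have hpos : (0 : ℝ) < #{i | f i = k'} := lt_of_lt_of_le
      (div_pos (Nat.cast_pos.2 (Fin.pos_iff_nonempty.2 ‹_›)) hK) hk'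
    obtain ⟨i, hi⟩ := Finset.card_pos.1 (Nat.cast_pos.1 hpos)
    simp only [Finset.mem_filter_univ] at hi
    exact hi ▸ hf i
  refine le_trans ?_ (sum_processing_times_le_mul_OPT I k')
  calc (⌈(m : ℝ) / (K : ℝ)⌉ : ℝ) * L + I.p j
      ≤ #{i | f i = k'} * L + I.p j := by gcongr
    _ = ∑ _i : Fin m with f _i = k', L + I.p j := by simp
    _ ≤ ∑ i : Fin m with f i = k',
          ∑ a ∈ I.S k' with a < j ∧ listScheduling I.p I.S a = i, I.p a + I.p j := by
        gcongr with i hi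
        simp only [Finset.mem_filter_univ] at hi
        exact hi ▸ hle i
    _ ≤ ∑ i : Fin m, ∑ a ∈ I.S k' with a < j ∧ listScheduling I.p I.S a = i, I.p a + I.p j := by
        refine add_le_add ?_ le_rfl
        exact Finset.sum_le_sum_of_subset_of_nonneg (Finset.subset_univ _)
          fun _ _ _ => Finset.sum_nonneg fun a _ => I.hp a
    _ = ∑ a ∈ I.S k' with a < j, I.p a + I.p j := by
        simp_rw [← Finset.filter_filter]
        rw [Finset.sum_fiberwise]
    _ = ∑ a ∈ insert j ((I.S k').filter (· < j)), I.p a := by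
        rw [Finset.sum_insert (by simp), add_comm]
    _ ≤ ∑ a ∈ I.S k', I.p a :=
        Finset.sum_le_sum_of_subset_of_nonneg
          (Finset.insert_subset hj (Finset.filter_subset _ _)) fun a _ _ => I.hp a

theorem load_listScheduling_le {m K : ℕ} [Nonempty (Fin m)] (I : OMSSInstance K) (i : Fin m)
    (k : Fin K) :
    load I (listScheduling I.p I.S) i k ≤
      (1 + ((m : ℝ) - 1) / (⌈(m : ℝ) / (K : ℝ)⌉ : ℝ)) * OPT m I := by
  have : Nonempty (Fin K) := ⟨k⟩
  have hm : 1 ≤ m := Fin.pos_iff_nonempty.2 ‹_›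
  have hK : (0 : ℝ) < K := Nat.cast_pos.2 (Fin.pos_iff_nonempty.2 ‹_›)
  have hc : (1 : ℝ) ≤ (⌈(m : ℝ) / (K : ℝ)⌉ : ℝ) := by
    exact_mod_cast Int.one_le_ceil_iff.2 (div_pos (Nat.cast_pos.2 hm) hK)
  have hm' : (1 : ℝ) ≤ m := by exact_mod_cast hm
  rcases ((I.S k).filter fun j => listScheduling I.p I.S j = i).eq_empty_or_nonempty with h | h
  · rw [load, h, Finset.sum_empty]
    exact mul_nonneg (add_nonneg zero_le_one (div_nonneg (by linarith) (by linarith)))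
      (OPT_nonneg I)
  · obtain ⟨j, hj, hmax⟩ := Finset.exists_max_image _ id h
    obtain ⟨hjS, rfl⟩ := Finset.mem_filter.1 hj
    have hload : load I (listScheduling I.p I.S) (listScheduling I.p I.S j : Fin m) k =
        ∑ a ∈ I.S k with
          a < j ∧ listScheduling I.p I.S a = (listScheduling I.p I.S j : Fin m), I.p a +
          I.p j := by
      rw [load, ← Finset.sum_erase_add _ _ hj]
      congr 1
      refine Finset.sum_congr ?_ fun _ _ => rfl
      ext a
      simp only [Finset.mem_erase, Finset.mem_filter]
      exact ⟨fun ⟨hne, haS, ha⟩ =>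
          ⟨haS, lt_of_le_of_ne (hmax a (Finset.mem_filter.2 ⟨haS, ha⟩)) hne, ha⟩,
        fun ⟨haS, hlt, ha⟩ => ⟨hlt.ne, haS, ha⟩⟩
    have hsum := ceil_mul_load_add_le_mul_OPT (m := m) I hjS
    have hp := processing_time_le_OPT (m := m) I hjS
    rw [hload]
    generalize (⌈(m : ℝ) / (K : ℝ)⌉ : ℝ) = c at *
    rw [one_add_div (by linarith), div_mul_eq_mul_div, le_div_iff₀ (by linarith)]
    linarith [mul_le_mul_of_nonneg_left hp (sub_nonneg.2 hc)]

/-- **Theorem (extended List Scheduling).** For `m > K ≥ 1` there is a deterministic online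
algorithm for `OMSS(m,K)` that is `(1 + (m-1)/⌈m/K⌉)`-competitive. -/
theorem exists_competitive_algorithm_pigeonhole (m K : ℕ) (hK : 1 ≤ K) (hmK : K < m) :
    ∃ A : OnlineAlg m K, ∀ I : OMSSInstance K,
      mkspan I (algAssign A I) ≤ (1 + ((m : ℝ) - 1) / (⌈(m : ℝ) / (K : ℝ)⌉ : ℝ)) * OPT m I := by
  have : Nonempty (Fin m) := ⟨⟨0, by omega⟩⟩
  refine ⟨fun j p S => listScheduling p S j, fun I => ?_⟩
  rw [algAssign_listScheduling]
  refine csSup_le ⟨_, ⟨0, hK⟩, Classical.arbitrary _, rfl⟩ ?_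
  rintro _ ⟨k, i, rfl⟩
  exact load_listScheduling_le I i k
end

section
/- Let m ≥ 2 and K ≥ 3 be integers. For every deterministic online algorithm A for OMSS(m,K) there exists an instance I with unit processing times (p_j = 1 for all j ∈ [n]) such that the makespan of A's assignment on I is at least 2·OPT(I). In particular, no deterministic online algorithm for OMSS(m,K) is r-competitive for any r < 2, even restricted to unit processing times. -/
open Finset

/-- An instance all of whose processing times are `1`. -/
def unitInstance {K : ℕ} (n : ℕ) (S : Fin K → Finset ℕ) (hS : ∀ k, S k ⊆ Finset.Icc 1 n) :
    OMSSInstance K where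
  n := n
  p := fun _ => 1
  hp := fun _ => zero_le_one
  S := S
  hS := hS

theorem load_unitInstance {m K n : ℕ} {S : Fin K → Finset ℕ} (hS : ∀ k, S k ⊆ Finset.Icc 1 n)
    (τ : ℕ → Fin m) (i : Fin m) (k : Fin K) :
    load (unitInstance n S hS) τ i k = #{j ∈ S k | τ j = i} := by
  simp [load, unitInstance]

theorem mkspan_nonneg {m K : ℕ} (I : OMSSInstance K) (τ : ℕ → Fin m) : 0 ≤ mkspan I τ := by
  refine Real.sSup_nonneg ?_
  rintro x ⟨k, i, rfl⟩
  exact Finset.sum_nonneg fun j _ => I.hp j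

theorem OPT_le_mkspan {m K : ℕ} (I : OMSSInstance K) (τ : ℕ → Fin m) :
    OPT m I ≤ mkspan I τ := by
  refine csInf_le ⟨0, ?_⟩ ⟨τ, rfl⟩
  rintro x ⟨σ, rfl⟩
  exact mkspan_nonneg I σ

theorem mkspan_unitInstance_le_one {m K n : ℕ} {S : Fin K → Finset ℕ}
    (hS : ∀ k, S k ⊆ Finset.Icc 1 n) (τ : ℕ → Fin m) (hτ : ∀ k, Set.InjOn τ (S k)) :
    mkspan (unitInstance n S hS) τ ≤ 1 := by
  refine Real.sSup_le ?_ zero_le_one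
  rintro x ⟨k, i, rfl⟩
  rw [load_unitInstance]
  norm_cast
  refine Finset.card_le_one.2 fun a ha b hb => ?_
  simp only [Finset.mem_filter] at ha hb
  exact hτ k ha.1 hb.1 (ha.2.trans hb.2.symm)

theorem one_le_OPT_unitInstance {m K n : ℕ} (hm : 0 < m) {S : Fin K → Finset ℕ}
    (hS : ∀ k, S k ⊆ Finset.Icc 1 n) {k : Fin K} (hk : (S k).Nonempty) :
    1 ≤ OPT m (unitInstance n S hS) := by
  obtain ⟨a, ha⟩ := hk
  refine le_csInf ⟨_, fun _ => ⟨0, hm⟩, rfl⟩ ?_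
  rintro x ⟨τ, rfl⟩
  refine le_trans ?_ (load_le_mkspan _ τ (τ a) k)
  rw [load_unitInstance]
  exact_mod_cast Finset.card_pos.2 ⟨a, by simp [ha]⟩

theorem two_le_mkspan_unitInstance {m K n : ℕ} {S : Fin K → Finset ℕ}
    (hS : ∀ k, S k ⊆ Finset.Icc 1 n) (τ : ℕ → Fin m) (hτ : ¬ ∀ k, Set.InjOn τ (S k)) :
    2 ≤ mkspan (unitInstance n S hS) τ := by
  simp only [Set.InjOn, not_forall] at hτ
  obtain ⟨k, a, ha, b, hb, hab, hne⟩ := hτ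
  refine le_trans ?_ (load_le_mkspan _ τ (τ a) k)
  rw [load_unitInstance]
  exact_mod_cast Finset.one_lt_card.2 ⟨a, by simpa using ha, b, by simpa [hab] using hb, hne⟩

theorem not_injOn_Icc_of_lt {m a b : ℕ} (h : m + a ≤ b) (τ : ℕ → Fin m) :
    ¬ Set.InjOn τ (Finset.Icc a b) := by
  intro hτ
  have := Finset.card_le_card_of_injOn τ (t := Finset.univ) (fun _ _ => by simp) hτ
  simp only [Nat.card_Icc, Finset.card_univ, Fintype.card_fin] at this
  omega

/-- Job `1` in scenario `0` only, job `2` in scenario `1` only, and `m - 1` jobs in both. -/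
def twoScenarioSet (m K : ℕ) (k : Fin K) : Finset ℕ :=
  if k.val = 0 then insert 1 (Finset.Icc 3 (m + 1))
  else if k.val = 1 then insert 2 (Finset.Icc 3 (m + 1))
  else ∅

/-- Job `1` in scenario `0` only, job `2` in scenario `1` only, `m - 1` jobs in scenarios `0`
and `2`, and a last job in scenarios `1` and `2`. -/
def threeScenarioSet (m K : ℕ) (k : Fin K) : Finset ℕ :=
  if k.val = 0 then insert 1 (Finset.Icc 3 (m + 1))
  else if k.val = 1 then {2, m + 2}
  else if k.val = 2 then Finset.Icc 3 (m + 2)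
  else ∅

theorem twoScenarioSet_subset {m K : ℕ} (hm : 2 ≤ m) (k : Fin K) :
    twoScenarioSet m K k ⊆ Finset.Icc 1 (m + 1) := by
  intro j hj
  unfold twoScenarioSet at hj
  split_ifs at hj <;> simp at hj ⊢ <;> omega

theorem threeScenarioSet_subset {m K : ℕ} (k : Fin K) :
    threeScenarioSet m K k ⊆ Finset.Icc 1 (m + 2) := by
  intro j hj
  unfold threeScenarioSet at hj
  split_ifs at hj <;> simp at hj ⊢ <;> omega

theorem twoScenarioSet_inter_eq {m K j : ℕ} (hm : 2 ≤ m) (hj : j ≤ 2) (k : Fin K) :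
    twoScenarioSet m K k ∩ Finset.Icc 1 j = threeScenarioSet m K k ∩ Finset.Icc 1 j := by
  ext x
  unfold twoScenarioSet threeScenarioSet
  split_ifs <;> simp <;> omega

theorem exists_injOn_twoScenarioSet {m : ℕ} (K : ℕ) (hm : 2 ≤ m) :
    ∃ τ : ℕ → Fin m, ∀ k, Set.InjOn τ (twoScenarioSet m K k) := by
  refine ⟨fun j => if h : j - 2 < m then ⟨j - 2, h⟩ else ⟨0, by omega⟩, fun k a ha b hb hab => ?_⟩
  unfold twoScenarioSet at ha hb
  simp only [apply_dite Fin.val, Fin.ext_iff] at hab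
  split_ifs at ha hb <;> simp at ha hb <;> split_ifs at hab <;> omega

theorem exists_injOn_threeScenarioSet {m : ℕ} (K : ℕ) (hm : 2 ≤ m) :
    ∃ τ : ℕ → Fin m, ∀ k, Set.InjOn τ (threeScenarioSet m K k) := by
  refine ⟨fun j => if j = 2 then ⟨1, by omega⟩
    else if h : j - 2 < m then ⟨j - 2, h⟩ else ⟨0, by omega⟩, fun k a ha b hb hab => ?_⟩
  unfold threeScenarioSet at ha hb
  simp only [apply_ite Fin.val, apply_dite Fin.val, Fin.ext_iff] at hab
  split_ifs at ha hb <;> simp at ha hb <;> split_ifs at hab <;> omega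

theorem not_injOn_twoScenarioSet {m K : ℕ} (hK : 3 ≤ K) (τ : ℕ → Fin m) (h : τ 1 ≠ τ 2) :
    ¬ ∀ k, Set.InjOn τ (twoScenarioSet m K k) := by
  intro hτ
  have h0 := hτ ⟨0, by omega⟩
  have h1 := hτ ⟨1, by omega⟩
  simp only [twoScenarioSet, Set.InjOn] at h0 h1
  refine not_injOn_Icc_of_lt (m := m) (a := 1) (b := m + 1) le_rfl τ fun a ha b hb hab => ?_
  simp at ha hb h0 h1
  grind

theorem not_injOn_threeScenarioSet {m K : ℕ} (hK : 3 ≤ K) (τ : ℕ → Fin m) (h : τ 1 = τ 2) :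
    ¬ ∀ k, Set.InjOn τ (threeScenarioSet m K k) := by
  intro hτ
  have h0 := hτ ⟨0, by omega⟩
  have h1 := hτ ⟨1, by omega⟩
  have h2 := hτ ⟨2, by omega⟩
  simp only [threeScenarioSet, Set.InjOn] at h0 h1 h2
  refine not_injOn_Icc_of_lt (m := m) (a := 2) (b := m + 2) le_rfl τ fun a ha b hb hab => ?_
  simp at ha hb h0 h1 h2
  grind

theorem exists_unitInstance_two_le_mkspan {m K : ℕ} (hm : 2 ≤ m) (hK : 3 ≤ K)
    (A : OnlineAlg m K) :
    ∃ I : OMSSInstance K, (∀ j, 1 ≤ j → j ≤ I.n → I.p j = 1) ∧ OPT m I = 1 ∧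
      2 ≤ mkspan I (algAssign A I) := by
  set I₂ := unitInstance (m + 1) (twoScenarioSet m K) (twoScenarioSet_subset hm)
  set I₃ := unitInstance (m + 2) (threeScenarioSet m K) threeScenarioSet_subset
  have hagree : ∀ j ≤ 2, algAssign A I₂ j = algAssign A I₃ j := by
    intro j hj
    have hS : (fun k => I₂.S k ∩ Finset.Icc 1 j) = fun k => I₃.S k ∩ Finset.Icc 1 j :=
      funext fun k => twoScenarioSet_inter_eq hm hj k
    unfold algAssign
    rw [hS]
    rfl
  by_cases h : algAssign A I₃ 1 = algAssign A I₃ 2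
  · obtain ⟨τ, hτ⟩ := exists_injOn_threeScenarioSet K hm
    refine ⟨I₃, fun _ _ _ => rfl, le_antisymm ?_ ?_, ?_⟩
    · exact (OPT_le_mkspan _ τ).trans (mkspan_unitInstance_le_one _ τ hτ)
    · exact one_le_OPT_unitInstance (by omega) _ (k := ⟨0, by omega⟩)
        ⟨1, by simp [threeScenarioSet]⟩
    · exact two_le_mkspan_unitInstance _ _ (not_injOn_threeScenarioSet hK _ h)
  · obtain ⟨τ, hτ⟩ := exists_injOn_twoScenarioSet K hm
    rw [← hagree 1 (by omega), ← hagree 2 le_rfl] at h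
    refine ⟨I₂, fun _ _ _ => rfl, le_antisymm ?_ ?_, ?_⟩
    · exact (OPT_le_mkspan _ τ).trans (mkspan_unitInstance_le_one _ τ hτ)
    · exact one_le_OPT_unitInstance (by omega) _ (k := ⟨0, by omega⟩)
        ⟨1, by simp [twoScenarioSet]⟩
    · exact two_le_mkspan_unitInstance _ _ (not_injOn_twoScenarioSet hK _ h)

/-- **Lower bound for `m ≥ 2`, `K ≥ 3`.** Every deterministic online algorithm admits an
instance with unit processing times on which its makespan is at least twice the optimum;
consequently no deterministic online algorithm is `r`-competitive for `r < 2`, even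
restricted to unit processing times. -/
theorem no_better_than_two_competitive (m K : ℕ) (hm : 2 ≤ m) (hK : 3 ≤ K) :
    (∀ A : OnlineAlg m K, ∃ I : OMSSInstance K,
        (∀ j, 1 ≤ j → j ≤ I.n → I.p j = 1) ∧
        2 * OPT m I ≤ mkspan I (algAssign A I)) ∧
      ∀ r : ℝ, r < 2 →
        ¬ ∃ A : OnlineAlg m K, ∀ I : OMSSInstance K,
            (∀ j, 1 ≤ j → j ≤ I.n → I.p j = 1) →
            mkspan I (algAssign A I) ≤ r * OPT m I := by
  refine ⟨fun A => ?_, ?_⟩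
  · obtain ⟨I, hp, hOPT, hA⟩ := exists_unitInstance_two_le_mkspan hm hK A
    exact ⟨I, hp, by linarith⟩
  · rintro r hr ⟨A, hA⟩
    obtain ⟨I, hp, hOPT, hI⟩ := exists_unitInstance_two_le_mkspan hm hK A
    have := hA I hp
    rw [hOPT] at this
    linarith
end

section
/- Consider OMSS(2,2), an instance of n jobs with n ∈ S_1 ∩ S_2, and an assignment of the first n−1 jobs to machines J_1, J_2. Write x_1 = p(J_1 ∩ S_1 ∩ [n−1]), x_2 = p(J_1 ∩ S_2 ∩ [n−1]), x_3 = p(J_2 ∩ S_1 ∩ [n−1]), x_4 = p(J_2 ∩ S_2 ∩ [n−1]). Assume x_1 = x_4, x_1 ≥ x_2, x_1 ≥ x_3 (so the makespan of the partial schedule is attained at J_1 ∩ S_1), x_4 > x_3, and max{x_2, x_3} > 0, and let α = x_1 / max{ x_2, x_3 + x_1 − x_4 } be the anticipation of the partial schedule. Then for every processing time p_n ≥ 0 of job n and either choice of machine for job n, the resulting schedule of all n jobs has proxy competitive ratio at most (2α+1)/(α+1). -/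
open Finset

/-- Load of machine `i` in scenario `k` among the first `t` jobs. -/
noncomputable def loadUpTo {m K : ℕ} (I : OMSSInstance K) (τ : ℕ → Fin m) (i : Fin m)
    (k : Fin K) (t : ℕ) : ℝ :=
  ∑ j ∈ (I.S k ∩ Finset.Icc 1 t).filter (fun j => τ j = i), I.p j

/-- The makespan contribution of machine `i` among the first `t` jobs (for `OMSS(2,2)`). -/
noncomputable def pMax (I : OMSSInstance 2) (τ : ℕ → Fin 2) (i : Fin 2) (t : ℕ) : ℝ :=
  max (loadUpTo I τ i 0 t) (loadUpTo I τ i 1 t)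

/-- The other one of the two machines. -/
def otherMach : Fin 2 → Fin 2 := fun i => if i = 0 then 1 else 0

/-- Rule 1 for `OMSS(2,2)`: a double-scenario job `j ∈ S_1 ∩ S_2` is assigned to a machine
`i` such that the makespan of the partial schedule on `[j-1]` is attained by the other
machine; if both machines attain it, `j` goes to the machine of job `j-1`
(and job `1` goes to the first machine). -/
def ObeysRule1 (A : OnlineAlg 2 2) : Prop :=
  ∀ I : OMSSInstance 2, ∀ j : ℕ, 1 ≤ j → j ≤ I.n → j ∈ I.S 0 → j ∈ I.S 1 →
    pMax I (algAssign A I) (otherMach (algAssign A I j)) (j - 1)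
        = max (pMax I (algAssign A I) 0 (j - 1)) (pMax I (algAssign A I) 1 (j - 1)) ∧
      (pMax I (algAssign A I) 0 (j - 1) = pMax I (algAssign A I) 1 (j - 1) →
        algAssign A I j = if j = 1 then 0 else algAssign A I (j - 1))

/-- Completion time of job `j`: the maximum over the scenarios containing `j` of the load,
among the first `j` jobs, of `j`'s machine in that scenario. -/
noncomputable def compTime (I : OMSSInstance 2) (τ : ℕ → Fin 2) (j : ℕ) : ℝ :=
  max (if j ∈ I.S 0 then loadUpTo I τ (τ j) 0 j else 0)
    (if j ∈ I.S 1 then loadUpTo I τ (τ j) 1 j else 0)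

/-- The largest completion time of a job of the instance. -/
noncomputable def maxCompTime (I : OMSSInstance 2) (τ : ℕ → Fin 2) : ℝ :=
  sSup {x | ∃ j : ℕ, 1 ≤ j ∧ j ≤ I.n ∧ x = compTime I τ j}

/-- Proxy competitive ratio of a schedule for `OMSS(2,2)`:
the makespan divided by the maximum of the largest average scenario load and the largest
processing time of a job whose completion time attains the overall maximum. -/
noncomputable def proxyRatio (I : OMSSInstance 2) (τ : ℕ → Fin 2) : ℝ :=
  (sSup {x | ∃ i : Fin 2, ∃ k : Fin 2, x = load I τ i k}) /
    max (max ((∑ j ∈ I.S 0, I.p j) / 2) ((∑ j ∈ I.S 1, I.p j) / 2))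
      (sSup {x | ∃ j : ℕ, 1 ≤ j ∧ j ≤ I.n ∧ compTime I τ j = maxCompTime I τ ∧ x = I.p j})

theorem loadUpTo_mono {m K : ℕ} (I : OMSSInstance K) (τ : ℕ → Fin m) (i : Fin m) (k : Fin K) :
    Monotone (loadUpTo I τ i k) := by
  intro s t hst
  refine Finset.sum_le_sum_of_subset_of_nonneg ?_ fun j _ _ => I.hp j
  exact Finset.filter_subset_filter _
    (Finset.inter_subset_inter_left (Finset.Icc_subset_Icc_right hst))

theorem loadUpTo_nonneg {m K : ℕ} (I : OMSSInstance K) (τ : ℕ → Fin m) (i : Fin m) (k : Fin K)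
    (t : ℕ) : 0 ≤ loadUpTo I τ i k t :=
  Finset.sum_nonneg fun j _ => I.hp j

theorem load_eq_loadUpTo {m K : ℕ} (I : OMSSInstance K) (τ : ℕ → Fin m) (i : Fin m)
    (k : Fin K) : load I τ i k = loadUpTo I τ i k I.n := by
  rw [load, loadUpTo, Finset.inter_eq_left.mpr (I.hS k)]

theorem loadUpTo_succ {m K : ℕ} (I : OMSSInstance K) (τ : ℕ → Fin m) (i : Fin m) (k : Fin K)
    (t : ℕ) (ht : t + 1 ∈ I.S k) :
    loadUpTo I τ i k (t + 1) = loadUpTo I τ i k t + if τ (t + 1) = i then I.p (t + 1) else 0 := by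
  have h : I.S k ∩ Finset.Icc 1 (t + 1) = insert (t + 1) (I.S k ∩ Finset.Icc 1 t) := by
    ext j
    simp only [Finset.mem_inter, Finset.mem_Icc, Finset.mem_insert]
    constructor
    · rintro ⟨hj, h1, h2⟩
      by_cases hjt : j = t + 1
      · exact Or.inl hjt
      · exact Or.inr ⟨hj, h1, by lia⟩
    · rintro (rfl | ⟨hj, h1, h2⟩)
      · exact ⟨ht, by lia, le_rfl⟩
      · exact ⟨hj, h1, by lia⟩
  rw [loadUpTo, loadUpTo, h, Finset.sum_filter, Finset.sum_filter,
    Finset.sum_insert (by simp), add_comm]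

theorem sum_scenario_eq_load_add_load {K : ℕ} (I : OMSSInstance K) (τ : ℕ → Fin 2) (k : Fin K) :
    ∑ j ∈ I.S k, I.p j = load I τ 0 k + load I τ 1 k := by
  rw [← Finset.sum_fiberwise (I.S k) τ I.p, Fin.sum_univ_two, load, load]

/-- Completion times of jobs of the instance are at most any common bound on the loads. -/
theorem compTime_le_of_load_le (I : OMSSInstance 2) (τ : ℕ → Fin 2) {B : ℝ}
    (hB : ∀ i k, load I τ i k ≤ B) {j : ℕ} (hj : j ≤ I.n) : compTime I τ j ≤ B := by
  have h : ∀ i k, loadUpTo I τ i k j ≤ B := fun i k =>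
    (loadUpTo_mono I τ i k hj).trans (load_eq_loadUpTo I τ i k ▸ hB i k)
  have h0 : 0 ≤ B := (loadUpTo_nonneg I τ 0 0 j).trans (h 0 0)
  unfold compTime
  refine max_le ?_ ?_ <;> split_ifs <;> first | exact h _ _ | exact h0

/-- If the completion time of a job bounds all loads, its processing time is at most the largest
processing time of a job with maximum completion time. -/
theorem le_sSup_p_of_load_le_compTime (I : OMSSInstance 2) (τ : ℕ → Fin 2) {j : ℕ} (hj1 : 1 ≤ j)
    (hj : j ≤ I.n) (hB : ∀ i k, load I τ i k ≤ compTime I τ j) :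
    I.p j ≤
      sSup {x | ∃ j : ℕ, 1 ≤ j ∧ j ≤ I.n ∧ compTime I τ j = maxCompTime I τ ∧ x = I.p j} := by
  refine le_csSup ⟨∑ i ∈ Finset.Icc 1 I.n, I.p i, ?_⟩ ⟨j, hj1, hj, ?_, rfl⟩
  · rintro x ⟨i, hi1, hi, -, rfl⟩
    exact Finset.single_le_sum (fun l _ => I.hp l) (Finset.mem_Icc.mpr ⟨hi1, hi⟩)
  · refine Eq.symm (IsGreatest.csSup_eq ⟨⟨j, hj1, hj, rfl⟩, ?_⟩)
    rintro x ⟨i, -, hi, rfl⟩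
    exact compTime_le_of_load_le I τ hB hi

/-- A load `a + q` against the larger of `q` and an average load of at least `(a + M + q) / 2`. -/
theorem load_div_le_of_anticipation {a M q N D : ℝ} (ha : 0 ≤ a) (hM : 0 < M) (hq : 0 ≤ q)
    (hN : N ≤ a + q) (hD : (a + M + q) / 2 ≤ D) (hqD : q ≤ D) :
    N / D ≤ (2 * (a / M) + 1) / (a / M + 1) := by
  have hDpos : 0 < D := lt_of_lt_of_le (by positivity) hD
  have h : (2 * (a / M) + 1) / (a / M + 1) = (2 * a + M) / (a + M) := by
    field_simp
  rw [h, div_le_div_iff₀ hDpos (by positivity)]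
  refine (mul_le_mul_of_nonneg_right hN (by positivity)).trans ?_
  rcases le_total q (a + M) with hc | hc
  · nlinarith [mul_le_mul_of_nonneg_left hD (by positivity : 0 ≤ 2 * a + M),
      mul_le_mul_of_nonneg_left hc hM.le]
  · nlinarith [mul_le_mul_of_nonneg_left hqD (by positivity : 0 ≤ 2 * a + M),
      mul_le_mul_of_nonneg_left hc ha]

/-- **Anticipation bounds the proxy ratio.** For `OMSS(2,2)` with `n ∈ S₁ ∩ S₂`, consider a
schedule `τ` whose loads on the first `n-1` jobs are `x₁ = p(J₁∩S₁)`, `x₂ = p(J₁∩S₂)`,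
`x₃ = p(J₂∩S₁)`, `x₄ = p(J₂∩S₂)` with `x₁ = x₄`, `x₁ ≥ x₂`, `x₁ ≥ x₃`, `x₄ > x₃` and
`max{x₂,x₃} > 0`, and let `α = x₁ / max{x₂, x₃ + x₁ - x₄}` be the anticipation. Then for
every processing time of job `n` and either choice of its machine, the resulting schedule of
all `n` jobs has proxy competitive ratio at most `(2α+1)/(α+1)`. -/
theorem anticipation_bounds_proxy_ratio (I : OMSSInstance 2) (τ : ℕ → Fin 2)
    (hn : 1 ≤ I.n) (hn0 : I.n ∈ I.S 0) (hn1 : I.n ∈ I.S 1)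
    (x1 x2 x3 x4 α : ℝ)
    (hx1 : x1 = loadUpTo I τ 0 0 (I.n - 1))
    (hx2 : x2 = loadUpTo I τ 0 1 (I.n - 1))
    (hx3 : x3 = loadUpTo I τ 1 0 (I.n - 1))
    (hx4 : x4 = loadUpTo I τ 1 1 (I.n - 1))
    (h14 : x1 = x4) (h12 : x2 ≤ x1) (h13 : x3 ≤ x1) (h34 : x3 < x4)
    (hpos : 0 < max x2 x3)
    (hα : α = x1 / max x2 (x3 + x1 - x4)) :
    proxyRatio I τ ≤ (2 * α + 1) / (α + 1) := by
  obtain ⟨t, ht⟩ : ∃ t, I.n = t + 1 := ⟨I.n - 1, by lia⟩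
  have hload : ∀ i k, load I τ i k =
      loadUpTo I τ i k (I.n - 1) + if τ I.n = i then I.p I.n else 0 := by
    intro i k
    have hk : I.n ∈ I.S k := by fin_cases k <;> assumption
    rw [ht] at hk
    rw [load_eq_loadUpTo, ht, loadUpTo_succ I τ i k t hk, Nat.add_sub_cancel]
  have hx1n : 0 ≤ x1 := hx1 ▸ loadUpTo_nonneg I τ 0 0 _
  have hp := I.hp I.n
  have hle : ∀ i k, load I τ i k ≤ x1 + I.p I.n := by
    intro i k
    rw [hload]
    have hx : loadUpTo I τ i k (I.n - 1) ≤ x1 := by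
      fin_cases i <;> fin_cases k <;> simp only [Fin.mk_one, Fin.zero_eta] <;> linarith
    split_ifs <;> linarith
  have hcomp : x1 + I.p I.n ≤ compTime I τ I.n := by
    simp only [compTime, if_pos hn0, if_pos hn1, ← load_eq_loadUpTo, hload, if_true]
    rcases Fin.exists_fin_two.mp ⟨τ I.n, rfl⟩ with h | h
    · rw [h, ← hx1]
      exact le_max_left _ _
    · rw [h, ← hx4, h14]
      exact le_max_right _ _
  have hα' : α = x1 / max x2 x3 := by rw [hα, h14, add_sub_cancel_right]
  rw [hα']
  have hsum : ∀ k, ∑ j ∈ I.S k, I.p j =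
      loadUpTo I τ 0 k (I.n - 1) + loadUpTo I τ 1 k (I.n - 1) + I.p I.n := by
    intro k
    rw [sum_scenario_eq_load_add_load I τ, hload, hload]
    rcases Fin.exists_fin_two.mp ⟨τ I.n, rfl⟩ with h | h <;> simp [h] <;> ring
  refine load_div_le_of_anticipation hx1n hpos hp ?_ ?_ ?_
  · refine csSup_le ⟨_, 0, 0, rfl⟩ ?_
    rintro x ⟨i, k, rfl⟩
    exact hle i k
  · refine le_max_of_le_left ?_
    rw [hsum, hsum, ← hx1, ← hx2, ← hx3, ← hx4]
    rcases le_total x2 x3 with h | h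
    · rw [max_eq_right h]
      exact le_max_left _ _
    · rw [max_eq_left h]
      exact le_max_of_le_right (by linarith)
  · exact le_max_of_le_right
      (le_sSup_p_of_load_le_compTime I τ hn le_rfl fun i k => (hle i k).trans hcomp)
end

section
/- For every deterministic online algorithm A for OMHC(3), there exists a hypergraph instance H with at most 233 hyperedges, each of size at most 3, such that OPT(H) = 1 and A's coloring of H has makespan 3 (i.e., some hyperedge of size 3 is monochromatic under A's coloring). Consequently, for every K ≥ 233 and every r < 3, there is no r-competitive deterministic online algorithm for OMHC(3), even restricted to instances with at most K hyperedges of size at most 3. -/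
open Finset

/-- An instance of Online Makespan Hypergraph Coloring: a hypergraph on nodes `{1,…,n}`. -/
structure OMHCInstance where
  n : ℕ
  E : Finset (Finset ℕ)
  hE : ∀ e ∈ E, e ⊆ Finset.Icc 1 n

/-- A deterministic online algorithm for `OMHC(m)`: the color of node `j` is a function
only of `j` and the partial hyperedges `e ∩ [j]`. -/
abbrev OMHCAlg (m : ℕ) := ℕ → Finset (Finset ℕ) → Fin m

/-- The coloring produced by online algorithm `A` on instance `I`. -/
def omhcAssign {m : ℕ} (A : OMHCAlg m) (I : OMHCInstance) : ℕ → Fin m :=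
  fun j => A j (I.E.image (fun e => e ∩ Finset.Icc 1 j))

/-- Makespan of a coloring: `max_{e ∈ E} max_{i ∈ [m]} |e ∩ φ⁻¹(i)|`. -/
def omhcMakespan (m : ℕ) (I : OMHCInstance) (φ : ℕ → Fin m) : ℕ :=
  I.E.sup (fun e => Finset.univ.sup (fun i : Fin m => (e.filter (fun v => φ v = i)).card))

/-- Offline optimum of an `OMHC(m)` instance: the minimum makespan over all colorings. -/
noncomputable def omhcOPT (m : ℕ) (I : OMHCInstance) : ℕ :=
  sInf {v | ∃ φ : ℕ → Fin m, v = omhcMakespan m I φ}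

/-- A hyperforest is a hypergraph without a hypercycle, i.e. without a cyclic sequence
`v_1, e_1, v_2, …, e_ℓ, v_{ℓ+1} = v_1` of pairwise distinct hyperedges `e_t` with
`v_t, v_{t+1} ∈ e_t` (consecutive nodes being distinct). -/
def IsHyperforest (E : Finset (Finset ℕ)) : Prop :=
  ¬ ∃ (l : ℕ) (v : ℕ → ℕ) (e : ℕ → Finset ℕ),
      1 ≤ l ∧
      (∀ t < l, e t ∈ E) ∧
      (∀ s < l, ∀ t < l, s ≠ t → e s ≠ e t) ∧
      (∀ t < l, v t ∈ e t ∧ v ((t + 1) % l) ∈ e t ∧ v t ≠ v ((t + 1) % l))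

/-- The coloring produced by `A` when the hyperedges are `E`. -/
def onlineColor (A : OMHCAlg 3) (E : Finset (Finset ℕ)) (j : ℕ) : Fin 3 :=
  A j (E.image (fun e => e ∩ Finset.Icc 1 j))

/-- The port `g` can be continued by a node of offline color `k`; a singleton port is
normalized to have color `k + 1`. -/
def AcceptsColor (ψ : ℕ → Fin 3) (g : Finset ℕ) (k : Fin 3) : Prop :=
  ∀ x ∈ g, ψ x ≠ k ∧ (g.card = 1 → ψ x = k + 1)

/-- `g` is a monochromatic partial hyperedge in color `m.2`, of size two if `m.1` and of size
one otherwise. -/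
def IsPort (φ : ℕ → Fin 3) (g : Finset ℕ) (m : Bool × Fin 3) : Prop :=
  (∀ x ∈ g, φ x = m.2) ∧ g.card = if m.1 then 2 else 1

/-- A position of the game against `A`: the hyperedges `E` revealed on the nodes `1, …, N`, and
the ports `Q`, whose offline colors can be prescribed independently. -/
structure Position (A : OMHCAlg 3) (N : ℕ) (E : Finset (Finset ℕ)) (Q : Multiset (Finset ℕ)) :
    Prop where
  subset_Icc : ∀ e ∈ E, e ⊆ Finset.Icc 1 N
  card_le : ∀ e ∈ E, e.card ≤ 3
  empty_mem : ∅ ∈ E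
  nodup : Q.Nodup
  port_mem : ∀ g ∈ Q, g ∈ E
  free : ∀ t : Finset ℕ → Fin 3, ∃ ψ : ℕ → Fin 3,
    (∀ e ∈ E, Set.InjOn ψ e) ∧ ∀ g ∈ Q, AcceptsColor ψ g (t g)

/-- A position with at most `n + 1` hyperedges and ports of types `M` can be reached. -/
def Reachable (A : OMHCAlg 3) (n : ℕ) (M : Multiset (Bool × Fin 3)) : Prop :=
  ∃ (N : ℕ) (E : Finset (Finset ℕ)) (Q : Multiset (Finset ℕ)), Position A N E Q ∧
    E.card ≤ n + 1 ∧ Multiset.Rel (IsPort (onlineColor A E)) Q M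

/-- The hyperedges after revealing a new node `v` that continues the hyperedges in `D`. -/
def revealNode (E D : Finset (Finset ℕ)) (v : ℕ) : Finset (Finset ℕ) :=
  insert {v} ((E \ D) ∪ D.image (insert v))

lemma mem_revealNode {E D : Finset (Finset ℕ)} {v : ℕ} {e : Finset ℕ} :
    e ∈ revealNode E D v ↔ e = {v} ∨ (e ∈ E ∧ e ∉ D) ∨ ∃ g ∈ D, insert v g = e := by
  simp [revealNode]

lemma card_revealNode_le {E D : Finset (Finset ℕ)} (h : D ⊆ E) (v : ℕ) :
    (revealNode E D v).card ≤ E.card + 1 := by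
  have h₁ := Finset.card_insert_le ({v} : Finset ℕ) ((E \ D) ∪ D.image (insert v))
  have h₂ := Finset.card_union_le (E \ D) (D.image (insert v))
  have h₃ : (D.image (insert v)).card ≤ D.card := Finset.card_image_le
  have h₄ := Finset.card_sdiff_add_card_eq_card h
  unfold revealNode
  omega

lemma onlineColor_revealNode (A : OMHCAlg 3) {E D : Finset (Finset ℕ)} {N : ℕ}
    (h0 : ∅ ∈ E) (hD : D ⊆ E) {j : ℕ} (hj : j ≤ N) :
    onlineColor A (revealNode E D (N + 1)) j = onlineColor A E j := by
  unfold onlineColor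
  congr 1
  have hins : ∀ g : Finset ℕ, insert (N + 1) g ∩ Finset.Icc 1 j = g ∩ Finset.Icc 1 j := by
    intro g
    apply Finset.insert_inter_of_notMem
    simp; omega
  ext s
  simp only [Finset.mem_image, mem_revealNode]
  constructor
  · rintro ⟨e, rfl | ⟨he, -⟩ | ⟨g, hg, rfl⟩, rfl⟩
    · exact ⟨∅, h0, by rw [← insert_empty_eq, hins]⟩
    · exact ⟨e, he, rfl⟩
    · exact ⟨g, hD hg, (hins g).symm⟩
  · rintro ⟨e, he, rfl⟩
    by_cases h : e ∈ D
    · exact ⟨_, Or.inr (Or.inr ⟨e, h, rfl⟩), hins e⟩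
    · exact ⟨e, Or.inr (Or.inl ⟨he, h⟩), rfl⟩

lemma Position.exists_coloring_revealNode {A : OMHCAlg 3} {N : ℕ} {E : Finset (Finset ℕ)}
    {Q₁ Q₂ : Multiset (Finset ℕ)} (h : Position A N E (Q₁ + Q₂)) (t : Finset ℕ → Fin 3)
    (k : Fin 3) :
    ∃ ψ : ℕ → Fin 3, (∀ e ∈ revealNode E Q₁.toFinset (N + 1), Set.InjOn ψ e) ∧
      ψ (N + 1) = k ∧ (∀ g ∈ Q₁, AcceptsColor ψ g k) ∧ ∀ g ∈ Q₂, AcceptsColor ψ g (t g) := by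
  classical
  obtain ⟨ψ, hψ, hport⟩ := h.free (fun g => if g ∈ Q₁ then k else t g)
  have hne : ∀ e ∈ E, ∀ x ∈ e, x ≠ N + 1 := by
    intro e he x hx
    have := h.subset_Icc e he hx
    simp at this; omega
  have hupd : ∀ e ∈ E, ∀ x ∈ e, Function.update ψ (N + 1) k x = ψ x := fun e he x hx =>
    Function.update_of_ne (hne e he x hx) _ _
  have hmem₁ : ∀ g ∈ Q₁, g ∈ E := fun g hg => h.port_mem g (Multiset.mem_add.2 (Or.inl hg))
  have hmem₂ : ∀ g ∈ Q₂, g ∈ E := fun g hg => h.port_mem g (Multiset.mem_add.2 (Or.inr hg))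
  have hQ₁ : ∀ g ∈ Q₁, AcceptsColor (Function.update ψ (N + 1) k) g k := by
    intro g hg x hx
    rw [hupd g (hmem₁ g hg) x hx]
    have := hport g (Multiset.mem_add.2 (Or.inl hg)) x hx
    simpa only [if_pos hg] using this
  have hinj : ∀ e ∈ E, Set.InjOn (Function.update ψ (N + 1) k) e := by
    intro e he x hx y hy hxy
    rw [hupd e he x hx, hupd e he y hy] at hxy
    exact hψ e he hx hy hxy
  refine ⟨Function.update ψ (N + 1) k, ?_, by simp, hQ₁, ?_⟩
  · intro e he
    rcases mem_revealNode.1 he with rfl | ⟨he, -⟩ | ⟨g, hg, rfl⟩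
    · simp
    · exact hinj e he
    · have hg := Multiset.mem_toFinset.1 hg
      rw [Finset.coe_insert, Set.injOn_insert (fun hv => hne g (hmem₁ g hg) _ hv rfl)]
      refine ⟨hinj g (hmem₁ g hg), ?_⟩
      rintro ⟨x, hx, hxv⟩
      exact (hQ₁ g hg x hx).1 (by simpa using hxv)
  · intro g hg x hx
    rw [hupd g (hmem₂ g hg) x hx]
    have hg' : g ∉ Q₁ := fun h' => Multiset.disjoint_left.1 (Multiset.nodup_add.1 h.nodup).2.2 h' hg
    have := hport g (Multiset.mem_add.2 (Or.inr hg)) x hx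
    simpa only [if_neg hg'] using this

lemma Position.revealNode {A : OMHCAlg 3} {N : ℕ} {E : Finset (Finset ℕ)}
    {Q₁ Q₂ : Multiset (Finset ℕ)} (h : Position A N E (Q₁ + Q₂))
    (hcard : ∀ g ∈ Q₁, g.card ≤ 2) (hne : ∀ g ∈ Q₁, g ≠ ∅) {g' : Finset ℕ}
    (hg' : g' = {N + 1} ∨ ∃ g ∈ Q₁, g.card = 1 ∧ g' = insert (N + 1) g) :
    Position A (N + 1) (revealNode E Q₁.toFinset (N + 1)) (g' ::ₘ Q₂) := by
  have hsub : ∀ e ∈ E, e ⊆ Finset.Icc 1 (N + 1) := fun e he =>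
    (h.subset_Icc e he).trans (Finset.Icc_subset_Icc_right (Nat.le_succ N))
  have hnv : ∀ e ∈ E, N + 1 ∉ e := by
    intro e he hv
    have := h.subset_Icc e he hv
    simp at this
  have hmem₁ : ∀ g ∈ Q₁, g ∈ E := fun g hg => h.port_mem g (Multiset.mem_add.2 (Or.inl hg))
  have hmem₂ : ∀ g ∈ Q₂, g ∈ E := fun g hg => h.port_mem g (Multiset.mem_add.2 (Or.inr hg))
  have hvg' : N + 1 ∈ g' := by
    rcases hg' with rfl | ⟨g, -, -, rfl⟩ <;> simp
  refine ⟨?_, ?_, ?_, ?_, ?_, ?_⟩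
  · intro e he
    rcases mem_revealNode.1 he with rfl | ⟨he, -⟩ | ⟨g, hg, rfl⟩
    · simp
    · exact hsub e he
    · exact Finset.insert_subset (by simp) (hsub g (hmem₁ g (Multiset.mem_toFinset.1 hg)))
  · intro e he
    rcases mem_revealNode.1 he with rfl | ⟨he, -⟩ | ⟨g, hg, rfl⟩
    · simp
    · exact h.card_le e he
    · have := Finset.card_insert_le (N + 1) g
      have := hcard g (Multiset.mem_toFinset.1 hg)
      omega
  · exact mem_revealNode.2 (Or.inr (Or.inl ⟨h.empty_mem, fun h0 =>
      hne ∅ (Multiset.mem_toFinset.1 h0) rfl⟩))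
  · exact Multiset.nodup_cons.2
      ⟨fun hg => hnv g' (hmem₂ g' hg) hvg', (Multiset.nodup_add.1 h.nodup).2.1⟩
  · intro g hg
    rcases Multiset.mem_cons.1 hg with rfl | hg
    · rcases hg' with rfl | ⟨g₀, hg₀, -, rfl⟩
      · exact mem_revealNode.2 (Or.inl rfl)
      · exact mem_revealNode.2 (Or.inr (Or.inr ⟨g₀, Multiset.mem_toFinset.2 hg₀, rfl⟩))
    · refine mem_revealNode.2 (Or.inr (Or.inl ⟨hmem₂ g hg, fun h' => ?_⟩))
      exact Multiset.disjoint_left.1 (Multiset.nodup_add.1 h.nodup).2.2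
        (Multiset.mem_toFinset.1 h') hg
  · intro t
    obtain ⟨ψ, hψ, hv, hQ₁, hQ₂⟩ := h.exists_coloring_revealNode t (t g' + 1)
    have hadd : ∀ k : Fin 3, k + 1 ≠ k ∧ k + 1 + 1 ≠ k := by decide
    refine ⟨ψ, hψ, fun g hg => ?_⟩
    rcases Multiset.mem_cons.1 hg with rfl | hg
    · rcases hg' with rfl | ⟨g₀, hg₀, hg₁, rfl⟩
      · intro x hx
        obtain rfl := Finset.mem_singleton.1 hx
        rw [hv]
        exact ⟨(hadd _).1, fun _ => rfl⟩
      · intro x hx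
        refine ⟨?_, fun hc => ?_⟩
        · rcases Finset.mem_insert.1 hx with rfl | hx
          · rw [hv]; exact (hadd _).1
          · rw [(hQ₁ g₀ hg₀ x hx).2 hg₁]; exact (hadd _).2
        · rw [Finset.card_insert_of_notMem (hnv g₀ (hmem₁ g₀ hg₀))] at hc
          omega
    · exact hQ₂ g hg

lemma reachable_zero (A : OMHCAlg 3) : Reachable A 0 0 :=
  ⟨0, {∅}, 0, ⟨by simp, by simp, by simp, by simp, by simp, fun _ => ⟨fun _ => 0, by simp⟩⟩,
    by simp, Multiset.Rel.zero⟩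

lemma Reachable.mono {A : OMHCAlg 3} {n n' : ℕ} {M M' : Multiset (Bool × Fin 3)}
    (h : Reachable A n M) (hn : n ≤ n') (hM : M' ≤ M) : Reachable A n' M' := by
  obtain ⟨N, E, Q, hpos, hE, hrel⟩ := h
  obtain ⟨U, rfl⟩ := Multiset.le_iff_exists_add.1 hM
  obtain ⟨Q₁, Q₂, h₁, -, rfl⟩ := Multiset.rel_add_right.1 hrel
  refine ⟨N, E, Q₁, ⟨hpos.subset_Icc, hpos.card_le, hpos.empty_mem,
    (Multiset.nodup_add.1 hpos.nodup).1,
    fun g hg => hpos.port_mem g (Multiset.mem_add.2 (Or.inl hg)), fun t => ?_⟩, by omega, h₁⟩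
  obtain ⟨ψ, hψ, hport⟩ := hpos.free t
  exact ⟨ψ, hψ, fun g hg => hport g (Multiset.mem_add.2 (Or.inl hg))⟩

/-- Every hyperedge of some instance with at most `K` hyperedges of size at most three can be made
rainbow offline, while `A` leaves one of size three monochromatic. -/
def Defeated (A : OMHCAlg 3) (K : ℕ) : Prop :=
  ∃ (N : ℕ) (E : Finset (Finset ℕ)), (∀ e ∈ E, e ⊆ Finset.Icc 1 N) ∧ (∀ e ∈ E, e.card ≤ 3) ∧
    E.card ≤ K ∧ (∃ ψ : ℕ → Fin 3, ∀ e ∈ E, Set.InjOn ψ e) ∧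
    ∃ e ∈ E, e.card = 3 ∧ ∃ c, ∀ x ∈ e, onlineColor A E x = c

/-- Revealing a node that continues the ports `D`. -/
lemma Reachable.move {A : OMHCAlg 3} {K n : ℕ} (hA : ¬ Defeated A K) (hn : n + 2 ≤ K)
    {M' : Multiset (Bool × Fin 3)} (h : Reachable A n M') (D M : Multiset (Bool × Fin 3))
    (hM' : M' = D + M) :
    ∃ c, (true, c) ∉ D ∧
      (((false, c) ∈ D ∧ Reachable A (n + 1) ({(true, c)} + M)) ∨
        ((false, c) ∉ D ∧ Reachable A (n + 1) ({(false, c)} + M))) := by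
  subst hM'
  obtain ⟨N, E, Q, hpos, hE, hrel⟩ := h
  obtain ⟨Q₁, Q₂, h₁, h₂, rfl⟩ := Multiset.rel_add_right.1 hrel
  have hmem₁ : ∀ g ∈ Q₁, g ∈ E := fun g hg => hpos.port_mem g (Multiset.mem_add.2 (Or.inl hg))
  have hmem₂ : ∀ g ∈ Q₂, g ∈ E := fun g hg => hpos.port_mem g (Multiset.mem_add.2 (Or.inr hg))
  have hsub : Q₁.toFinset ⊆ E := fun g hg => hmem₁ g (Multiset.mem_toFinset.1 hg)
  have hcard : ∀ g ∈ Q₁, g.card = 1 ∨ g.card = 2 := by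
    intro g hg
    obtain ⟨m, -, -, hm⟩ := Multiset.exists_mem_of_rel_of_mem h₁ hg
    split_ifs at hm <;> omega
  have hpos' := fun g' => hpos.revealNode (g' := g') (fun g hg => by have := hcard g hg; omega)
    (fun g hg => by rintro rfl; simpa using hcard _ hg)
  have hE' : (revealNode E Q₁.toFinset (N + 1)).card ≤ n + 1 + 1 :=
    (card_revealNode_le hsub _).trans (by omega)
  set E' := revealNode E Q₁.toFinset (N + 1)
  have hcol : ∀ e ∈ E, ∀ x ∈ e, onlineColor A E' x = onlineColor A E x := fun e he x hx =>
    onlineColor_revealNode A hpos.empty_mem hsub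
      (Finset.mem_Icc.1 (hpos.subset_Icc e he hx)).2
  have hnv : ∀ e ∈ E, N + 1 ∉ e := by
    intro e he hv
    have := hpos.subset_Icc e he hv
    simp at this
  have h₂' : Multiset.Rel (IsPort (onlineColor A E')) Q₂ M := h₂.mono fun g hg m _ hgm =>
    ⟨fun x hx => by rw [hcol g (hmem₂ g hg) x hx]; exact hgm.1 x hx, hgm.2⟩
  have hext : ∀ b, (b, onlineColor A E' (N + 1)) ∈ D → ∃ g ∈ Q₁,
      g.card = (if b then 2 else 1) ∧ (insert (N + 1) g).card = g.card + 1 ∧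
      ∀ x ∈ insert (N + 1) g, onlineColor A E' x = onlineColor A E' (N + 1) := by
    intro b hb
    obtain ⟨g, hg, hgm⟩ := Multiset.exists_mem_of_rel_of_mem (Multiset.rel_flip.2 h₁) hb
    refine ⟨g, hg, hgm.2, Finset.card_insert_of_notMem (hnv g (hmem₁ g hg)), fun x hx => ?_⟩
    rcases Finset.mem_insert.1 hx with rfl | hx
    · rfl
    · rw [hcol g (hmem₁ g hg) x hx]; exact hgm.1 x hx
  simp only [Multiset.singleton_add]
  refine ⟨onlineColor A E' (N + 1), fun hD => hA ?_, ?_⟩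
  · obtain ⟨g, hg, hg2, hgv, hmono⟩ := hext true hD
    have hp := hpos' _ (Or.inl rfl)
    obtain ⟨ψ, hψ, -⟩ := hp.free (fun _ => 0)
    exact ⟨N + 1, E', hp.subset_Icc, hp.card_le, by omega, ⟨ψ, hψ⟩, insert (N + 1) g,
      mem_revealNode.2 (Or.inr (Or.inr ⟨g, Multiset.mem_toFinset.2 hg, rfl⟩)),
      by rw [hgv, hg2]; rfl, _, hmono⟩
  · by_cases hD : (false, onlineColor A E' (N + 1)) ∈ D
    · obtain ⟨g, hg, hg1, hgv, hmono⟩ := hext false hD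
      exact Or.inl ⟨hD, N + 1, E', _, hpos' _ (Or.inr ⟨g, hg, by simpa using hg1, rfl⟩), hE',
        Multiset.Rel.cons ⟨hmono, by rw [hgv, hg1]; rfl⟩ h₂'⟩
    · exact Or.inr ⟨hD, N + 1, E', _, hpos' _ (Or.inl rfl), hE',
        Multiset.Rel.cons ⟨by simp, by simp⟩ h₂'⟩

section Strategy

variable {A : OMHCAlg 3} {K n : ℕ} {M : Multiset (Bool × Fin 3)}

lemma Reachable.fresh (h : Reachable A n M) (hA : ¬ Defeated A K) (hn : n + 2 ≤ K) :
    ∃ c, Reachable A (n + 1) ({(false, c)} + M) := by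
  obtain ⟨c, -, ⟨h', -⟩ | ⟨-, h'⟩⟩ := h.move hA hn 0 M (by simp)
  · simp at h'
  · exact ⟨c, h'⟩

lemma Reachable.pair_or_two_colors (h : Reachable A n M) (hA : ¬ Defeated A K) (hn : n + 4 ≤ K) :
    (∃ c, Reachable A (n + 3) ({(true, c)} + M)) ∨
      ∃ c d, c ≠ d ∧ Reachable A (n + 3) ({(false, c)} + {(false, d)} + M) := by
  obtain ⟨c, h₁⟩ := h.fresh hA (by omega)
  obtain ⟨d, h₂⟩ := h₁.fresh hA (by omega)
  rcases ne_or_eq c d with hcd | rfl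
  · exact Or.inr ⟨c, d, hcd, h₂.mono (by omega) (by apply le_of_eq; abel)⟩
  · obtain ⟨d, -, ⟨-, h₃⟩ | ⟨hd, h₃⟩⟩ :=
      h₂.move hA (by omega) {(false, c)} ({(false, c)} + M) rfl
    · exact Or.inl ⟨d, h₃.mono (by omega) (add_le_add_right (Multiset.le_add_left _ _) _)⟩
    · refine Or.inr ⟨c, d, fun hcd => hd (by simp [hcd]), h₃.mono (by omega) ?_⟩
      apply le_of_eq; abel

lemma fin_three_eq_of_ne {c d e : Fin 3} (hcd : c ≠ d) (hce : c ≠ e) (hde : d ≠ e) (x : Fin 3) :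
    x = c ∨ x = d ∨ x = e := by
  revert c d e x; decide

lemma Reachable.pair_of_three_colors {c d e : Fin 3}
    (h : Reachable A n ({(false, c)} + {(false, d)} + {(false, e)} + M))
    (hcd : c ≠ d) (hce : c ≠ e) (hde : d ≠ e) (hA : ¬ Defeated A K) (hn : n + 2 ≤ K) :
    ∃ x, Reachable A (n + 1) ({(true, x)} + M) := by
  obtain ⟨x, -, ⟨-, h'⟩ | ⟨hx, -⟩⟩ := h.move hA hn _ _ rfl
  · exact ⟨x, h'⟩
  · refine absurd ?_ hx
    have := fin_three_eq_of_ne hcd hce hde x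
    simpa [or_assoc] using this

lemma Reachable.pair (h : Reachable A n M) (hA : ¬ Defeated A K) (hn : n + 9 ≤ K) :
    ∃ c, Reachable A (n + 8) ({(true, c)} + M) := by
  obtain ⟨c, h₁⟩ | ⟨c, d, hcd, h₁⟩ := h.pair_or_two_colors hA (by omega)
  · exact ⟨c, h₁.mono (by omega) le_rfl⟩
  obtain ⟨x, h₂⟩ | ⟨c', d', hcd', h₂⟩ := h₁.pair_or_two_colors hA (by omega)
  · exact ⟨x, h₂.mono (by omega) (add_le_add_right (Multiset.le_add_left _ _) _)⟩
  have three : ∀ e, c ≠ e → d ≠ e →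
      Reachable A (n + 7) ({(false, c)} + {(false, d)} + {(false, e)} + M) →
      ∃ c, Reachable A (n + 8) ({(true, c)} + M) := fun e hce hde h₃ =>
    h₃.pair_of_three_colors hcd hce hde hA (by omega)
  by_cases hc' : c' = c ∨ c' = d
  · by_cases hd' : d' = c ∨ d' = d
    · obtain ⟨x, -, ⟨-, h₃⟩ | ⟨hx, h₃⟩⟩ := h₂.move hA (by omega) ({(false, c')} + {(false, d')}) _ rfl
      · exact ⟨x, h₃.mono (by omega) (add_le_add_right (Multiset.le_add_left _ _) _)⟩
      · have hx' : c ≠ x ∧ d ≠ x := by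
          simp only [Multiset.mem_add, Multiset.mem_singleton, Prod.mk.injEq, true_and] at hx
          clear * - hcd hcd' hc' hd' hx
          grind
        exact three x hx'.1 hx'.2 (h₃.mono (by omega) (by apply le_of_eq; abel))
    · push Not at hd'
      exact three d' hd'.1.symm hd'.2.symm (h₂.mono (by omega)
        (Multiset.le_iff_exists_add.2 ⟨{(false, c')}, by abel⟩))
  · push Not at hc'
    exact three c' hc'.1.symm hc'.2.symm (h₂.mono (by omega)
      (Multiset.le_iff_exists_add.2 ⟨{(false, d')}, by abel⟩))

lemma Reachable.pairs (hA : ¬ Defeated A K) (k : ℕ) (hk : 8 * k + 1 ≤ K) :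
    ∃ T : Multiset (Fin 3), T.card = k ∧ Reachable A (8 * k) (T.map (Prod.mk true)) := by
  induction k with
  | zero => exact ⟨0, rfl, reachable_zero A⟩
  | succ k ih =>
    obtain ⟨T, hT, h⟩ := ih (by omega)
    obtain ⟨c, h⟩ := h.pair hA (by omega)
    exact ⟨{c} + T, by simp [hT, add_comm], by simpa [mul_add] using h⟩

lemma Reachable.pair_of_ne (c : Fin 3) (h : Reachable A n (4 • {(true, c)} + M))
    (hA : ¬ Defeated A K) (hn : n + 5 ≤ K) :
    ∃ d, d ≠ c ∧ Reachable A (n + 4) ({(true, d)} + M) := by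
  obtain ⟨d, hd, ⟨hd', -⟩ | ⟨-, h₁⟩⟩ :=
    h.move hA (by omega) {(true, c)} (3 • {(true, c)} + M) (by abel)
  · simp at hd'
  obtain ⟨e, he, ⟨he', -⟩ | ⟨-, h₂⟩⟩ := h₁.move hA (by omega) {(true, c)}
    ({(false, d)} + 2 • {(true, c)} + M) (by abel)
  · simp at he'
  have hdc : d ≠ c := by simpa using hd
  have hec : e ≠ c := by simpa using he
  have three : ∀ e, e ≠ c → d ≠ e →
      Reachable A (n + 3) ({(true, c)} + {(false, d)} + {(false, e)} + M) →
      ∃ d, d ≠ c ∧ Reachable A (n + 4) ({(true, d)} + M) := by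
    intro e hec hde h₃
    obtain ⟨x, hx, ⟨-, h₄⟩ | ⟨hx', -⟩⟩ := h₃.move hA (by omega) _ _ rfl
    · exact ⟨x, by simpa using hx, h₄⟩
    · have := fin_three_eq_of_ne hdc.symm hec.symm hde x
      simp at hx hx'
      tauto
  rcases ne_or_eq d e with hde | rfl
  · exact three e hec hde (h₂.mono (by omega)
      (Multiset.le_iff_exists_add.2 ⟨{(true, c)}, by abel⟩))
  obtain ⟨e, he, ⟨-, h₃⟩ | ⟨hx, h₃⟩⟩ := h₂.move hA (by omega) ({(true, c)} + {(false, d)})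
    ({(false, d)} + {(true, c)} + M) (by abel)
  · exact ⟨e, by simpa using he, h₃.mono (by omega)
      (Multiset.le_iff_exists_add.2 ⟨{(false, d)} + {(true, c)}, by abel⟩)⟩
  · exact three e (by simpa using he) (fun hde => hx (by simp [hde]))
      (h₃.mono (by omega) (by apply le_of_eq; abel))

lemma Reachable.false_of_three_pairs {c d e : Fin 3}
    (h : Reachable A n ({(true, c)} + {(true, d)} + {(true, e)}))
    (hcd : c ≠ d) (hce : c ≠ e) (hde : d ≠ e) (hA : ¬ Defeated A K) (hn : n + 2 ≤ K) : False := by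
  obtain ⟨x, hx, -⟩ := h.move hA hn _ 0 (add_zero _).symm
  have := fin_three_eq_of_ne hcd hce hde x
  simp at hx
  tauto

lemma Reachable.false_of_two_colors {c d : Fin 3}
    (h : Reachable A n (3 • {(true, c)} + 3 • {(true, d)}))
    (hcd : c ≠ d) (hA : ¬ Defeated A K) (hn : n + 4 ≤ K) : False := by
  obtain ⟨e, he, ⟨he', -⟩ | ⟨-, h₁⟩⟩ := h.move hA (by omega) ({(true, c)} + {(true, d)})
    (2 • {(true, c)} + 2 • {(true, d)}) (by abel)
  · simp at he'
  have hce : c ≠ e := fun h => he (by simp [h])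
  have hde : d ≠ e := fun h => he (by simp [h])
  obtain ⟨x, hx, ⟨hx', h₂⟩ | ⟨hx', -⟩⟩ := h₁.move hA (by omega)
    ({(true, c)} + {(true, d)} + {(false, e)}) ({(true, c)} + {(true, d)}) (by abel)
  · obtain rfl : x = e := by simpa using hx'
    exact (h₂.mono le_rfl (by apply le_of_eq; abel)).false_of_three_pairs hcd hce hde hA (by omega)
  · have := fin_three_eq_of_ne hcd hce hde x
    simp at hx hx'
    tauto

lemma Reachable.false_of_one_color {c : Fin 3} (h : Reachable A n (15 • {(true, c)}))
    (hA : ¬ Defeated A K) (hn : n + 16 ≤ K) : False := by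
  obtain ⟨d₁, hd₁, h₁⟩ := Reachable.pair_of_ne c (M := 11 • {(true, c)})
    (h.mono le_rfl (by apply le_of_eq; abel)) hA (by omega)
  obtain ⟨d₂, hd₂, h₂⟩ := Reachable.pair_of_ne c (M := {(true, d₁)} + 7 • {(true, c)})
    (h₁.mono le_rfl (by apply le_of_eq; abel)) hA (by omega)
  obtain ⟨d₃, hd₃, h₃⟩ := Reachable.pair_of_ne c
    (M := {(true, d₁)} + {(true, d₂)} + 3 • {(true, c)})
    (h₂.mono le_rfl (by apply le_of_eq; abel)) hA (by omega)
  rcases ne_or_eq d₁ d₂ with h12 | rfl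
  · refine (h₃.mono le_rfl ?_).false_of_three_pairs hd₁.symm hd₂.symm h12 hA (by omega)
    exact Multiset.le_iff_exists_add.2 ⟨{(true, d₃)} + 2 • {(true, c)}, by abel⟩
  rcases ne_or_eq d₁ d₃ with h13 | rfl
  · refine (h₃.mono le_rfl ?_).false_of_three_pairs hd₁.symm hd₃.symm h13 hA (by omega)
    exact Multiset.le_iff_exists_add.2 ⟨{(true, d₁)} + 2 • {(true, c)}, by abel⟩
  · exact (h₃.mono le_rfl (by apply le_of_eq; abel)).false_of_two_colors hd₁.symm hA (by omega)

end Strategy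

theorem defeated_233 (A : OMHCAlg 3) : Defeated A 233 := by
  by_contra hA
  obtain ⟨T, hT, h⟩ := Reachable.pairs hA 17 (by norm_num)
  have hsum : T.count 0 + T.count 1 + T.count 2 = 17 := by
    rw [← hT, ← Multiset.sum_count_eq_card (s := Finset.univ) (by simp), Fin.sum_univ_three]
  have sub : ∀ U : Multiset (Fin 3), (∀ c, U.count c ≤ T.count c) →
      Reachable A (8 * 17) (U.map (Prod.mk true)) := fun U hU =>
    h.mono le_rfl (Multiset.map_le_map (Multiset.le_iff_count.2 hU))
  have one : ∀ c, T.count c < 15 := by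
    intro c
    by_contra! hc
    refine Reachable.false_of_one_color (c := c) (n := 8 * 17) ?_ hA (by norm_num)
    have h := sub (15 • {c}) fun d => by rcases eq_or_ne d c with rfl | hd <;> simp [*]
    rwa [Multiset.map_nsmul, Multiset.map_singleton] at h
  have two : ∀ c d, c ≠ d → T.count c < 3 ∨ T.count d < 3 := by
    intro c d hcd
    by_contra! hc
    refine Reachable.false_of_two_colors (n := 8 * 17) ?_ hcd hA (by norm_num)
    have h := sub (3 • {c} + 3 • {d}) fun e => by
      rcases eq_or_ne e c with rfl | hc' <;> rcases eq_or_ne e d with rfl | hd' <;> simp_all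
    rwa [Multiset.map_add, Multiset.map_nsmul, Multiset.map_nsmul, Multiset.map_singleton,
      Multiset.map_singleton] at h
  have three : T.count 0 = 0 ∨ T.count 1 = 0 ∨ T.count 2 = 0 := by
    by_contra! hc
    refine Reachable.false_of_three_pairs (n := 8 * 17) (c := 0) (d := 1) (e := 2) ?_ (by decide)
      (by decide) (by decide) hA (by norm_num)
    simpa using sub ({0} + {1} + {2}) fun e => by
      fin_cases e <;> simp <;> omega
  have := one 0
  have := one 1
  have := one 2
  have := two 0 1 (by decide)
  have := two 0 2 (by decide)
  have := two 1 2 (by decide)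
  omega

lemma omhcMakespan_le_one {I : OMHCInstance} {ψ : ℕ → Fin 3} (h : ∀ e ∈ I.E, Set.InjOn ψ e) :
    omhcMakespan 3 I ψ ≤ 1 := by
  refine Finset.sup_le fun e he => Finset.sup_le fun c _ => Finset.card_le_one.2 ?_
  intro x hx y hy
  rw [Finset.mem_filter] at hx hy
  exact h e he hx.1 hy.1 (hx.2.trans hy.2.symm)

lemma card_filter_le_omhcMakespan {I : OMHCInstance} (φ : ℕ → Fin 3) {e : Finset ℕ}
    (he : e ∈ I.E) (c : Fin 3) : (e.filter (fun v => φ v = c)).card ≤ omhcMakespan 3 I φ :=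
  (Finset.le_sup (f := fun c => (e.filter (fun v => φ v = c)).card) (Finset.mem_univ c)).trans
    (Finset.le_sup (f := fun e => Finset.univ.sup
      (fun c : Fin 3 => (e.filter (fun v => φ v = c)).card)) he)

lemma omhcOPT_eq_one {I : OMHCInstance} {ψ : ℕ → Fin 3} (h : ∀ e ∈ I.E, Set.InjOn ψ e)
    {e : Finset ℕ} (he : e ∈ I.E) (hne : e.Nonempty) : omhcOPT 3 I = 1 := by
  have hpos : ∀ φ : ℕ → Fin 3, 1 ≤ omhcMakespan 3 I φ := by
    intro φ
    obtain ⟨x, hx⟩ := hne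
    refine le_trans ?_ (card_filter_le_omhcMakespan φ he (φ x))
    exact Finset.card_pos.2 ⟨x, by simp [hx]⟩
  refine IsLeast.csInf_eq ⟨⟨ψ, le_antisymm (hpos ψ) (omhcMakespan_le_one h)⟩, ?_⟩
  rintro _ ⟨φ, rfl⟩
  exact hpos φ

lemma exists_instance_makespan_three (A : OMHCAlg 3) : ∃ I : OMHCInstance,
    I.E.card ≤ 233 ∧ (∀ e ∈ I.E, e.card ≤ 3) ∧ omhcOPT 3 I = 1 ∧
      omhcMakespan 3 I (omhcAssign A I) = 3 := by
  obtain ⟨N, E, hE, hcard, hK, ⟨ψ, hψ⟩, e, he, he3, c, hc⟩ := defeated_233 A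
  let I : OMHCInstance := ⟨N, E, hE⟩
  refine ⟨I, hK, hcard, omhcOPT_eq_one (I := I) hψ he (Finset.card_pos.1 (by omega)),
    le_antisymm ?_ ?_⟩
  · exact Finset.sup_le fun e he => Finset.sup_le fun c _ =>
      (Finset.card_filter_le _ _).trans (hcard e he)
  · have h := card_filter_le_omhcMakespan (I := I) (omhcAssign A I) he c
    rwa [Finset.filter_true_of_mem (p := fun v => omhcAssign A I v = c) hc, he3] at h

/-- **Theorem.** Every deterministic online algorithm for `OMHC(3)` admits an instance with
at most `233` hyperedges of size at most `3`, offline optimum `1`, and online makespan `3`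
(a monochromatic hyperedge of size 3). Consequently, for every `K ≥ 233` and `r < 3` there
is no `r`-competitive deterministic online algorithm for `OMHC(3)`, even restricted to
instances with at most `K` hyperedges of size at most `3`. -/
theorem omhc3_no_better_than_three :
    (∀ A : OMHCAlg 3, ∃ I : OMHCInstance,
        I.E.card ≤ 233 ∧ (∀ e ∈ I.E, e.card ≤ 3) ∧ omhcOPT 3 I = 1 ∧
        omhcMakespan 3 I (omhcAssign A I) = 3) ∧
      ∀ K : ℕ, 233 ≤ K → ∀ r : ℝ, r < 3 →
        ¬ ∃ A : OMHCAlg 3, ∀ I : OMHCInstance,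
            I.E.card ≤ K → (∀ e ∈ I.E, e.card ≤ 3) →
            (omhcMakespan 3 I (omhcAssign A I) : ℝ) ≤ r * (omhcOPT 3 I : ℝ) := by
  refine ⟨exists_instance_makespan_three, ?_⟩
  rintro K hK r hr ⟨A, hA⟩
  obtain ⟨I, hI, hcard, hopt, hmake⟩ := exists_instance_makespan_three A
  have h := hA I (hI.trans hK) hcard
  rw [hopt, hmake] at h
  norm_num at h
  linarith
end

section
/- For every partition of {1,…,7} into three nonempty sets J_1, J_2, J_3, there exists a feasible coloring c : {1,…,7} → {red, blue, yellow} of the hypergraph 𝒮 together with two nodes v, w lying in the same part J_i such that c(v) ≠ c(w). -/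
/-- The hyperedge set of the gadget hypergraph `𝒮` on the nodes `{1,…,7}`. -/
def Sedges : Finset (Finset ℕ) :=
  {{1, 2}, {1, 3}, {2, 3}, {1, 2, 3}, {2, 4}, {4, 5}, {2, 5}, {2, 4, 5},
   {4, 6}, {6, 7}, {4, 7}, {4, 6, 7}, {3, 6}, {3, 7}}

/-- The coloring of `𝒮` with color classes `{2, x}`, `{3, 4}` and everything else. -/
def spindleColoring (x n : ℕ) : Fin 3 :=
  if n = 2 ∨ n = x then 0 else if n = 3 ∨ n = 4 then 1 else 2

theorem spindleColoring_six_feasible :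
    ∀ e ∈ Sedges, ∀ v ∈ e, ∀ w ∈ e, v ≠ w → spindleColoring 6 v ≠ spindleColoring 6 w := by
  decide

theorem spindleColoring_seven_feasible :
    ∀ e ∈ Sedges, ∀ v ∈ e, ∀ w ∈ e, v ≠ w → spindleColoring 7 v ≠ spindleColoring 7 w := by
  decide

/-- Any two of the nodes `1, 2, 3, 6` are separated by one of the two colorings. -/
theorem spindleColoring_separates :
    ∀ v ∈ ({1, 2, 3, 6} : Finset ℕ), ∀ w ∈ ({1, 2, 3, 6} : Finset ℕ), v ≠ w →
      spindleColoring 6 v ≠ spindleColoring 6 w ∨ spindleColoring 7 v ≠ spindleColoring 7 w := by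
  decide

/-- **Lemma (palettes exist).** For every partition of `{1,…,7}` into three nonempty parts
`J₁, J₂, J₃` (given as a coloring `J` with all three fibers nonempty), there is a feasible
3-coloring `c` of `𝒮` (no hyperedge contains two nodes of the same color) together with two
nodes in the same part having different offline colors. -/
theorem palette_exists (J : ℕ → Fin 3)
    (hJ : ∀ i : Fin 3, ∃ v, v ∈ Finset.Icc 1 7 ∧ J v = i) :
    ∃ c : ℕ → Fin 3,
      (∀ e ∈ Sedges, ∀ v ∈ e, ∀ w ∈ e, v ≠ w → c v ≠ c w) ∧
      ∃ v ∈ Finset.Icc 1 7, ∃ w ∈ Finset.Icc 1 7, J v = J w ∧ c v ≠ c w := by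
  obtain ⟨v, hv, w, hw, hne, hJvw⟩ :=
    Finset.exists_ne_map_eq_of_card_lt_of_maps_to (s := ({1, 2, 3, 6} : Finset ℕ))
      (t := Finset.univ) (f := J) (by decide) (fun _ _ => Finset.mem_coe.2 (Finset.mem_univ _))
  have hsub : ({1, 2, 3, 6} : Finset ℕ) ⊆ Finset.Icc 1 7 := by decide
  rcases spindleColoring_separates v hv w hw hne with h | h
  · exact ⟨_, spindleColoring_six_feasible, v, hsub hv, w, hsub hw, hJvw, h⟩
  · exact ⟨_, spindleColoring_seven_feasible, v, hsub hv, w, hsub hw, hJvw, h⟩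
end

section
/- Define X(m,d) for integers m,d ≥ 1 by X(m,d) = 1 if m = 1 or d = 1, and X(m,d) = X(m−1,d)·((m−1)·X(m,d−1) + 1) + X(m,d−1) otherwise. Then for all integers m,d ≥ 1, X(m,d) ≤ ∏_{i=1}^{m+d} (m+d)^{2^i}. -/
/-- The recursion `X(m,d)` from Lemma 4.1: `X(m,d) = 1` if `m = 1` or `d = 1`, and
`X(m,d) = X(m-1,d)·((m-1)·X(m,d-1) + 1) + X(m,d-1)` otherwise. -/
def Xrec : ℕ → ℕ → ℕ
  | 0, _ => 1
  | _, 0 => 1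
  | 1, _ => 1
  | _, 1 => 1
  | m + 2, d + 2 =>
      Xrec (m + 1) (d + 2) * ((m + 1) * Xrec (m + 2) (d + 1) + 1) + Xrec (m + 2) (d + 1)
  termination_by m d => (m, d)

theorem Xrec_pos (m d : ℕ) : 0 < Xrec m d := by
  fun_induction Xrec m d <;> positivity

theorem Xrec_mul_le_pow (m d N : ℕ) (hN : m + d ≤ N) :
    Xrec m d * N ≤ N ^ 2 ^ (m + d) := by
  have base (k : ℕ) : 1 * N ≤ N ^ 2 ^ k := by
    rw [one_mul]
    exact Nat.le_self_pow (by positivity) N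
  fun_induction Xrec m d with
  | case1 | case2 | case3 | case4 => exact base _
  | case5 m d ihA ihB =>
    have hA := Xrec_pos (m + 1) (d + 2)
    have hB := Xrec_pos (m + 2) (d + 1)
    have ihA := ihA (by omega)
    have ihB := ihB (by omega)
    generalize Xrec (m + 1) (d + 2) = A at *
    generalize Xrec (m + 2) (d + 1) = B at *
    calc (A * ((m + 1) * B + 1) + B) * N
        ≤ ((m + 3) * (A * B)) * N := by
          gcongr
          nlinarith [Nat.le_mul_of_pos_right A hB, Nat.le_mul_of_pos_left B hA]
      _ ≤ (N * (A * B)) * N := by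
          gcongr
          omega
      _ = (A * N) * (B * N) := by ring
      _ ≤ N ^ 2 ^ (m + 1 + (d + 2)) * N ^ 2 ^ (m + 2 + (d + 1)) := Nat.mul_le_mul ihA ihB
      _ = N ^ 2 ^ (m + 2 + (d + 2)) := by
          rw [← pow_add]
          congr 1
          ring

/-- **Lemma.** `X(m,d) ≤ ∏_{i=1}^{m+d} (m+d)^(2^i)` for all `m, d ≥ 1`. -/
theorem Xrec_le_prod (m d : ℕ) (hm : 1 ≤ m) (hd : 1 ≤ d) :
    Xrec m d ≤ ∏ i ∈ Finset.Icc 1 (m + d), (m + d) ^ 2 ^ i := by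
  have hN : 0 < m + d := by omega
  calc Xrec m d ≤ Xrec m d * (m + d) := Nat.le_mul_of_pos_right _ hN
    _ ≤ (m + d) ^ 2 ^ (m + d) := Xrec_mul_le_pow m d (m + d) le_rfl
    _ ≤ ∏ i ∈ Finset.Icc 1 (m + d), (m + d) ^ 2 ^ i :=
      Finset.single_le_prod' (f := fun i => (m + d) ^ 2 ^ i)
        (fun i _ => Nat.one_le_pow _ _ hN) (Finset.mem_Icc.mpr ⟨hN, le_rfl⟩)
end

section
/- Define X(m,d) for integers m,d ≥ 1 by X(m,d) = 1 if m = 1 or d = 1, and X(m,d) = X(m−1,d)·((m−1)·X(m,d−1) + 1) + X(m,d−1) otherwise. Then for every integer m ≥ 1, X(m,m) ≤ (m+1)·(2m)^(2^(2m+1)). -/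
theorem Xrec_zero_left (d : ℕ) : Xrec 0 d = 1 := by
  rw [Xrec]

theorem Xrec_zero_right (m : ℕ) : Xrec m 0 = 1 := by
  rcases m with _ | _ | m <;> simp [Xrec]

theorem Xrec_one_left (d : ℕ) : Xrec 1 d = 1 := by
  rcases d with _ | _ | d <;> simp [Xrec]

theorem Xrec_one_right (m : ℕ) : Xrec m 1 = 1 := by
  rcases m with _ | _ | m <;> simp [Xrec]

theorem Xrec_add_two (m d : ℕ) : Xrec (m + 2) (d + 2) =
    Xrec (m + 1) (d + 2) * ((m + 1) * Xrec (m + 2) (d + 1) + 1) + Xrec (m + 2) (d + 1) := by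
  rw [Xrec]

/-- If `m ≤ N` then `X(m,d) ≤ (2N)^(2^(m+d) - 1)`, stated without subtraction. -/
theorem two_mul_mul_Xrec_le {N : ℕ} (hN : 1 ≤ N) (m d : ℕ) (hm : m ≤ N) :
    2 * N * Xrec m d ≤ (2 * N) ^ 2 ^ (m + d) := by
  have base (k : ℕ) : 2 * N * 1 ≤ (2 * N) ^ 2 ^ k := by
    rw [mul_one]
    exact Nat.le_self_pow (by positivity) _
  match m, d with
  | 0, d => rw [Xrec_zero_left]; exact base _
  | 1, d => rw [Xrec_one_left]; exact base _
  | m, 0 => rw [Xrec_zero_right]; exact base _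
  | m, 1 => rw [Xrec_one_right]; exact base _
  | m + 2, d + 2 =>
    have hA := two_mul_mul_Xrec_le hN (m + 1) (d + 2) (by omega)
    have hB := two_mul_mul_Xrec_le hN (m + 2) (d + 1) hm
    have pA := Xrec_pos (m + 1) (d + 2)
    have pB := Xrec_pos (m + 2) (d + 1)
    rw [show m + 1 + (d + 2) = m + d + 3 by ring] at hA
    rw [show m + 2 + (d + 1) = m + d + 3 by ring] at hB
    rw [Xrec_add_two, show m + 2 + (d + 2) = m + d + 3 + 1 by ring, pow_succ 2, mul_two, pow_add]
    generalize Xrec (m + 1) (d + 2) = A at *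
    generalize Xrec (m + 2) (d + 1) = B at *
    calc 2 * N * (A * ((m + 1) * B + 1) + B)
        = 2 * N * ((m + 1) * (A * B) + A * 1 + 1 * B) := by ring
      _ ≤ 2 * N * ((m + 1) * (A * B) + A * B + A * B) := by gcongr <;> exact Nat.succ_le_of_lt ‹_›
      _ = 2 * N * ((m + 3) * (A * B)) := by ring
      _ ≤ 2 * N * (2 * N * (A * B)) := by gcongr; omega
      _ = 2 * N * A * (2 * N * B) := by ring
      _ ≤ _ := Nat.mul_le_mul hA hB
  termination_by (m, d)

/-- `X(m,m) ≤ (m+1)·(2m)^(2^(2m+1))` for all `m ≥ 1`. -/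
theorem Xrec_diag_bound (m : ℕ) (hm : 1 ≤ m) :
    Xrec m m ≤ (m + 1) * (2 * m) ^ 2 ^ (2 * m + 1) := by
  calc Xrec m m ≤ 2 * m * Xrec m m := Nat.le_mul_of_pos_left _ (by positivity)
    _ ≤ (2 * m) ^ 2 ^ (m + m) := two_mul_mul_Xrec_le hm m m le_rfl
    _ ≤ (2 * m) ^ 2 ^ (2 * m + 1) :=
      Nat.pow_le_pow_right (by positivity) (Nat.pow_le_pow_right two_pos (by omega))
    _ ≤ (m + 1) * (2 * m) ^ 2 ^ (2 * m + 1) := Nat.le_mul_of_pos_left _ m.succ_pos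
end
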